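/- arXiv:1904.03290 — 2 statements merged into one kernel-verified Lean document; each statement's English description precedes it below -/
import Mathlib

section
/- Let x > 1 be a real number and let k ≥ 0 be an integer. Then the series ∑_{n=k+1}^∞ 1/(x^n − 1) converges, the series ∑_{j=1}^∞ x^{-jk}/(x^j − 1) converges, and the two sums are equal: ∑_{n=k+1}^∞ 1/(x^n − 1) = ∑_{j=1}^∞ x^{-jk}/(x^j − 1). (Equation (7) of Theorem 1(ii): the faster-converging expression for E[T] in the geometric pure-birth CF model, with E[T] = (1/P)·∑_{n>k} 1/(x^n − 1) where x = 1 + α and k = M0 − 1.) -/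
theorem cf_row (x : ℝ) (hx : 1 < x) (N a : ℕ) (hN : N ≠ 0) :
    HasSum (fun j : ℕ => x⁻¹ ^ (N * (a + 1 + j))) ((x⁻¹ ^ (N * a)) / (x ^ N - 1)) := by
  have h0 : 0 < x := by linarith
  have hN1 : 1 < x ^ N := one_lt_pow₀ hx hN
  have hq1 : x⁻¹ ^ N < 1 := by
    rw [inv_pow]; exact inv_lt_one_of_one_lt₀ hN1
  have h := (hasSum_geometric_of_lt_one (by positivity) hq1).mul_left (x⁻¹ ^ (N * (a + 1)))
  convert h using 1
  · rfl
  · funext j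
    rw [← pow_mul, ← pow_add]; ring_nf
  · have h2 : x ^ N - 1 ≠ 0 := by linarith
    have h3 : 1 - x⁻¹ ^ N ≠ 0 := by linarith
    have h4 : x⁻¹ ^ N * x ^ N = 1 := by rw [← mul_pow, inv_mul_cancel₀ h0.ne', one_pow]
    rw [mul_add, pow_add, mul_one, ← div_eq_mul_inv, div_eq_div_iff h2 h3]
    linear_combination (-x⁻¹ ^ (N * a)) * h4

/-- Equation (7) of Theorem 1(ii): for `x > 1` and an integer `k ≥ 0`, the series
`∑_{n=k+1}^∞ 1/(x^n − 1)` and `∑_{j=1}^∞ x^{-jk}/(x^j − 1)` both converge and have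
equal sums (the faster-converging expression for `E[T]` in the geometric pure-birth
CF model, where `x = 1 + α` and `k = M0 − 1`). -/
theorem cf_expectation_fast_series (x : ℝ) (hx : 1 < x) (k : ℕ) :
    Summable (fun n : ℕ => 1 / (x ^ (k + 1 + n) - 1)) ∧
    Summable (fun j : ℕ => x ^ (-(((j : ℤ) + 1) * k)) / (x ^ (j + 1) - 1)) ∧
    ∑' n : ℕ, 1 / (x ^ (k + 1 + n) - 1)
      = ∑' j : ℕ, x ^ (-(((j : ℤ) + 1) * k)) / (x ^ (j + 1) - 1) := by
  have h0 : 0 < x := by linarith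
  have hrow : ∀ n : ℕ, HasSum (fun j : ℕ => x⁻¹ ^ ((k + 1 + n) * (j + 1)))
      (1 / (x ^ (k + 1 + n) - 1)) := by
    intro n
    have h := cf_row x hx (k + 1 + n) 0 (by omega)
    simpa [add_comm, add_left_comm, add_assoc] using h
  have hcol : ∀ j : ℕ, HasSum (fun n : ℕ => x⁻¹ ^ ((k + 1 + n) * (j + 1)))
      (x ^ (-(((j : ℤ) + 1) * k)) / (x ^ (j + 1) - 1)) := by
    intro j
    have h := cf_row x hx (j + 1) k (by omega)
    have e : x ^ (-(((j : ℤ) + 1) * k)) = x⁻¹ ^ ((j + 1) * k) := by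
      rw [zpow_neg, inv_pow, ← zpow_natCast]; push_cast; rfl
    rw [e]
    simpa only [mul_comm (j + 1) (k + 1 + _)] using h
  have hs1 : Summable (fun n : ℕ => 1 / (x ^ (k + 1 + n) - 1)) := by
    have hg : Summable (fun n : ℕ => (x - 1)⁻¹ * x⁻¹ ^ n) :=
      (summable_geometric_of_lt_one (by positivity) (inv_lt_one_of_one_lt₀ hx)).mul_left _
    refine Summable.of_nonneg_of_le (fun n => ?_) (fun n => ?_) hg
    · have := one_lt_pow₀ hx (show k + 1 + n ≠ 0 by omega)
      exact one_div_nonneg.mpr (by linarith)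
    · rw [inv_pow, ← mul_inv, ← one_div]
      have h1 : x ^ (n + 1) ≤ x ^ (k + 1 + n) := pow_le_pow_right₀ hx.le (by omega)
      have h2 : 1 ≤ x ^ n := one_le_pow₀ hx.le
      rw [pow_succ] at h1
      exact one_div_le_one_div_of_le (mul_pos (by linarith) (by positivity)) (by nlinarith)
  have hs : Summable (fun p : ℕ × ℕ => x⁻¹ ^ ((k + 1 + p.1) * (p.2 + 1))) := by
    refine (summable_prod_of_nonneg (fun p => by positivity)).mpr ⟨fun n => (hrow n).summable, ?_⟩
    simpa only [(hrow _).tsum_eq] using hs1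
  have hA := hs.hasSum.prod_fiberwise hrow
  have hB := ((Equiv.prodComm ℕ ℕ).hasSum_iff.mpr hs.hasSum).prod_fiberwise hcol
  exact ⟨hs1, hB.summable, hA.tsum_eq.trans hB.tsum_eq.symm⟩
end

section
/- Let x > 1 be a real number and let k ≥ 0 be an integer. Then the series ∑_{n=k+1}^∞ 1/(x^n − 1)² converges, the series ∑_{j=1}^∞ j · x^{-(j+1)k}/(x^{j+1} − 1) converges, and the two sums are equal: ∑_{n=k+1}^∞ 1/(x^n − 1)² = ∑_{j=1}^∞ j · x^{-(j+1)k}/(x^{j+1} − 1). (Equation (8) of Theorem 1(ii): the faster-converging expression for Var[T] in the geometric pure-birth CF model, with Var[T] = (1/P²)·∑_{n>k} 1/(x^n − 1)² where x = 1 + α and k = M0 − 1.) -/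
theorem cf_aux_congr {f g : ℕ → ℝ} {a b : ℝ} (h : HasSum f a) (hfg : ∀ i, g i = f i)
    (hab : b = a) : HasSum g b := by
  have : g = f := funext hfg
  rw [this, hab]
  exact h

theorem cf_aux_geom (y : ℝ) (h0 : 0 ≤ y) (h1 : y < 1) :
    HasSum (fun j : ℕ => ((j : ℝ) + 1) * y ^ (j + 2)) (y * (y / (1 - y) ^ 2)) := by
  have h := hasSum_coe_mul_geometric_of_norm_lt_one (𝕜 := ℝ) (r := y)
    (by rw [Real.norm_eq_abs, abs_of_nonneg h0]; exact h1)
  have h2 := ((hasSum_nat_add_iff' 1).mpr h).mul_left y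
  simp only [Finset.sum_range_one, Nat.cast_zero, zero_mul, sub_zero] at h2
  refine cf_aux_congr h2 (fun j => ?_) rfl
  push_cast
  ring

/-- Equation (8) of Theorem 1(ii): for `x > 1` and an integer `k ≥ 0`, the series
`∑_{n=k+1}^∞ 1/(x^n − 1)²` and `∑_{j=1}^∞ j·x^{-(j+1)k}/(x^{j+1} − 1)` both converge
and have equal sums (the faster-converging expression for `Var[T]` in the geometric
pure-birth CF model, where `x = 1 + α` and `k = M0 − 1`). -/
theorem cf_variance_fast_series (x : ℝ) (hx : 1 < x) (k : ℕ) :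
    Summable (fun n : ℕ => 1 / (x ^ (k + 1 + n) - 1) ^ 2) ∧
    Summable (fun j : ℕ =>
      ((j : ℝ) + 1) * x ^ (-(((j : ℤ) + 2) * k)) / (x ^ (j + 2) - 1)) ∧
    ∑' n : ℕ, 1 / (x ^ (k + 1 + n) - 1) ^ 2
      = ∑' j : ℕ, ((j : ℝ) + 1) * x ^ (-(((j : ℤ) + 2) * k)) / (x ^ (j + 2) - 1) := by
  have hx0 : 0 < x := by linarith
  obtain ⟨q, hq⟩ : ∃ q, q = x⁻¹ := ⟨_, rfl⟩
  have q0 : 0 < q := by rw [hq]; positivity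
  have q1 : q < 1 := by rw [hq]; exact inv_lt_one_of_one_lt₀ hx
  have hpow : ∀ m : ℕ, x ^ m = (q ^ m)⁻¹ := by intro m; rw [hq, inv_pow, inv_inv]
  have hS : Summable (fun p : ℕ × ℕ => ((p.2 : ℝ) + 1) * q ^ ((k + 1 + p.1) * (p.2 + 2))) := by
    have h1 := (summable_geometric_of_lt_one q0.le q1).mul_of_nonneg
      (cf_aux_geom q q0.le q1).summable (fun n => by positivity) (fun n => by positivity)
    refine Summable.of_nonneg_of_le (fun p => by positivity) (fun p => ?_) h1
    have : q ^ ((k + 1 + p.1) * (p.2 + 2)) ≤ q ^ (p.1 + (p.2 + 2)) :=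
      pow_le_pow_of_le_one q0.le q1.le (by nlinarith [Nat.zero_le (k * (p.2+2)), Nat.zero_le (p.1 * p.2)])
    calc _ ≤ ((p.2 : ℝ) + 1) * q ^ (p.1 + (p.2 + 2)) := by gcongr
      _ = _ := by rw [pow_add]; ring
  have hA : ∀ n : ℕ, HasSum (fun j : ℕ => ((j : ℝ) + 1) * q ^ ((k + 1 + n) * (j + 2)))
      (1 / (x ^ (k + 1 + n) - 1) ^ 2) := by
    intro n
    have y0 : 0 < q ^ (k + 1 + n) := by positivity
    have y1 : q ^ (k + 1 + n) < 1 := pow_lt_one₀ q0.le q1 (by omega)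
    have h := cf_aux_geom _ y0.le y1
    simp only [← pow_mul] at h
    refine cf_aux_congr h (fun _ => rfl) ?_
    rw [hpow]
    generalize q ^ (k + 1 + n) = y at *
    have : 1 - y ≠ 0 := by linarith
    have e : y⁻¹ - 1 = (1 - y) / y := by field_simp
    rw [e]
    field_simp
  have hB : ∀ j : ℕ, HasSum (fun n : ℕ => ((j : ℝ) + 1) * q ^ ((k + 1 + n) * (j + 2)))
      (((j : ℝ) + 1) * x ^ (-(((j : ℤ) + 2) * k)) / (x ^ (j + 2) - 1)) := by
    intro j
    have y0 : 0 < q ^ (j + 2) := by positivity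
    have y1 : q ^ (j + 2) < 1 := pow_lt_one₀ q0.le q1 (by omega)
    have h := (hasSum_geometric_of_lt_one y0.le y1).mul_left
      (((j : ℝ) + 1) * (q ^ (j + 2)) ^ (k + 1))
    have e0 : x ^ (-(((j : ℤ) + 2) * k)) = (q ^ (j + 2)) ^ k := by
      rw [zpow_neg, ← pow_mul, hq, inv_pow, ← zpow_natCast]
      push_cast
      rfl
    refine cf_aux_congr h (fun n => ?_) ?_
    · rw [mul_comm (k + 1 + n), pow_mul, pow_add _ (k + 1) n, mul_assoc]
    · rw [e0, hpow]
      generalize q ^ (j + 2) = y at *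
      have : 1 - y ≠ 0 := by linarith
      have e : y⁻¹ - 1 = (1 - y) / y := by field_simp
      rw [e, pow_succ]
      field_simp
  have h1 := hS.hasSum.prod_fiberwise hA
  have h2 := ((Equiv.prodComm ℕ ℕ).hasSum_iff.mpr hS.hasSum).prod_fiberwise hB
  exact ⟨h1.summable, h2.summable, h1.tsum_eq.trans h2.tsum_eq.symm⟩
end
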